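/- In the Warden's Game on S ⊆ T(n,k) (closed under rotations), treating the goal α ∈ S as a start position with remoteness r(α) > 0, the position of greatest finite remoteness in S is α itself: no position has finite remoteness exceeding r(α). -/

import Mathlib

namespace UCG

abbrev Str (n k : ℕ) := Fin n → Fin k

def OneUp {n k : ℕ} (β γ : Str n k) : Prop :=
  ∃ i : Fin n, β i < γ i ∧ ∀ j : Fin n, j ≠ i → β j = γ j

def IncrTo {n k : ℕ} (S : Set (Str n k)) (β α : Str n k) : Prop :=
  β ∈ S ∧ Relation.ReflTransGen (fun x y => OneUp x y ∧ y ∈ S) β α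

def IsRotation {n k : ℕ} (β γ : Str n k) : Prop :=
  ∃ j : ℕ, ∀ i : Fin n, γ i = β ⟨(i.val + j) % n, Nat.mod_lt _ i.pos⟩

def ClosedUnderRot {n k : ℕ} (S : Set (Str n k)) : Prop :=
  ∀ β ∈ S, ∀ γ, IsRotation β γ → γ ∈ S

def shift {n k : ℕ} (c : Fin k) (β : Str n k) : Str n k :=
  fun i => if i.val = 0 then c else β ⟨i.val - 1, lt_of_le_of_lt (Nat.sub_le _ _) i.isLt⟩

def lastSym {n k : ℕ} (hn : 0 < n) (β : Str n k) : Fin k :=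
  β ⟨n - 1, Nat.sub_lt hn one_pos⟩

/-- `WinIn hn S tgt β m`: in the Warden's Game with legal positions `S`, starting
from position `β`, the prisoner can force the position `tgt` to be reached within
at most `m` moves, whatever the warden does.  A move from `β = γb` is either a
warden move to `cγ ∈ S` with `c < b`, or (if the warden passes) a prisoner move
to `cγ ∈ S` with `c ≥ b`. -/
inductive WinIn {n k : ℕ} (hn : 0 < n) (S : Set (Str n k)) (tgt : Str n k) :
    Str n k → ℕ → Prop
  | passWin (β : Str n k) (m : ℕ) (c : Fin k)
      (hc : lastSym hn β ≤ c) (hcS : shift c β ∈ S) (heq : shift c β = tgt)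
      (hW : ∀ c' : Fin k, c' < lastSym hn β → shift c' β ∈ S → shift c' β ≠ tgt →
        WinIn hn S tgt (shift c' β) m) :
      WinIn hn S tgt β (m + 1)
  | passStep (β : Str n k) (m : ℕ) (c : Fin k)
      (hc : lastSym hn β ≤ c) (hcS : shift c β ∈ S)
      (hwin : WinIn hn S tgt (shift c β) m)
      (hW : ∀ c' : Fin k, c' < lastSym hn β → shift c' β ∈ S → shift c' β ≠ tgt →
        WinIn hn S tgt (shift c' β) m) :
      WinIn hn S tgt β (m + 1)

noncomputable def remoteness {n k : ℕ} (hn : 0 < n) (S : Set (Str n k))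
    (tgt β : Str n k) : ℕ∞ :=
  sInf {e : ℕ∞ | ∃ t : ℕ, e = t ∧ WinIn hn S tgt β t}

def fshift {n k : ℕ} (b : Fin k) (β : Str n k) : Str n k :=
  fun i => if h : i.val = n - 1 then b else β ⟨i.val + 1, by have := i.isLt; omega⟩

def GreedyOk {n k : ℕ} (S : Set (Str n k)) (B : ℕ → Option (Str n k)) (m : ℕ)
    (β : Str n k) (b : Fin k) : Prop :=
  fshift b β ∈ S ∧ ∀ i : ℕ, 1 ≤ i → i ≤ m → B i ≠ some (fshift b β)

def IsGreedy {n k : ℕ} (S : Set (Str n k)) (α : Str n k)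
    (B : ℕ → Option (Str n k)) : Prop :=
  B 0 = some α ∧
  (∀ m : ℕ, B m = none → B (m + 1) = none) ∧
  ∀ m : ℕ, ∀ β : Str n k, B m = some β →
    ((1 ≤ m ∧ β = α) → B (m + 1) = none) ∧
    ((m = 0 ∨ β ≠ α) →
      ((¬ ∃ b : Fin k, GreedyOk S B m β b) → B (m + 1) = none) ∧
      (∀ b : Fin k, GreedyOk S B m β b → (∀ b' : Fin k, b' < b → ¬ GreedyOk S B m β b') →
        B (m + 1) = some (fshift b β)))

def CycSubstr {m n k : ℕ} (hn : 0 < n) (γ : Str m k) (β : Str n k) : Prop :=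
  ∃ j : ℕ, ∀ i : Fin m, β ⟨(j + i.val) % n, Nat.mod_lt _ hn⟩ = γ i

theorem shift_snoc {n k : ℕ} (c b : Fin k) (γ : Fin n → Fin k) :
    shift c (Fin.snoc γ b : Str (n + 1) k) = Fin.cons c γ := by
  funext i
  refine Fin.cases ?_ (fun j => ?_) i
  · simp [shift]
  · have hj : (⟨j.succ.val - 1, lt_of_le_of_lt (Nat.sub_le _ _) j.succ.isLt⟩ : Fin (n + 1))
        = j.castSucc := by ext; simp
    simp only [shift, hj, Fin.cons_succ, Fin.snoc_castSucc]
    simp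

theorem lastSym_snoc {n k : ℕ} (hn : 0 < n + 1) (b : Fin k) (γ : Fin n → Fin k) :
    lastSym hn (Fin.snoc γ b : Str (n + 1) k) = b :=
  Fin.snoc_last (α := fun _ => Fin k) b γ

theorem ClosedUnderRot.cons_mem {n k : ℕ} {S : Set (Str (n + 1) k)} (hS : ClosedUnderRot S)
    {γ : Fin n → Fin k} {b : Fin k} (h : (Fin.snoc γ b : Str (n + 1) k) ∈ S) :
    (Fin.cons b γ : Str (n + 1) k) ∈ S := by
  refine hS _ h _ ⟨n, fun i => ?_⟩
  refine Fin.cases ?_ (fun j => ?_) i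
  · have h0 : (⟨((0 : Fin (n + 1)).val + n) % (n + 1), Nat.mod_lt _ n.succ_pos⟩ : Fin (n + 1))
        = Fin.last n := by ext; simp
    simp only [h0, Fin.cons_zero, Fin.snoc_last]
  · have hj : (⟨(j.succ.val + n) % (n + 1), Nat.mod_lt _ n.succ_pos⟩ : Fin (n + 1))
        = j.castSucc := by
      ext
      have : j.succ.val + n = j.val + (n + 1) := by simp; omega
      simp only [this, Nat.add_mod_right, Fin.val_castSucc]
      exact Nat.mod_eq_of_lt (by omega)
    simp only [hj, Fin.cons_succ, Fin.snoc_castSucc]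

theorem ClosedUnderRot.snoc_mem {n k : ℕ} {S : Set (Str (n + 1) k)} (hS : ClosedUnderRot S)
    {γ : Fin n → Fin k} {b : Fin k} (h : (Fin.cons b γ : Str (n + 1) k) ∈ S) :
    (Fin.snoc γ b : Str (n + 1) k) ∈ S := by
  refine hS _ h _ ⟨1, fun i => ?_⟩
  refine Fin.lastCases ?_ (fun j => ?_) i
  · have h0 : (⟨((Fin.last n).val + 1) % (n + 1), Nat.mod_lt _ n.succ_pos⟩ : Fin (n + 1))
        = 0 := by ext; simp
    simp only [h0, Fin.cons_zero, Fin.snoc_last]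
  · have hj : (⟨(j.castSucc.val + 1) % (n + 1), Nat.mod_lt _ n.succ_pos⟩ : Fin (n + 1))
        = j.succ := by
      ext
      simp only [Fin.val_castSucc, Fin.val_succ]
      exact Nat.mod_eq_of_lt (by omega)
    simp only [hj, Fin.cons_succ, Fin.snoc_castSucc]

theorem not_winIn_zero {n k : ℕ} {hn : 0 < n} {S : Set (Str n k)} {α β : Str n k} :
    ¬ WinIn hn S α β 0 := nofun

theorem winIn_snoc_succ {n k : ℕ} {hn : 0 < n + 1} {S : Set (Str (n + 1) k)}
    {α : Str (n + 1) k} {γ : Fin n → Fin k} {b : Fin k} {m : ℕ} :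
    WinIn hn S α (Fin.snoc γ b) (m + 1) ↔
      (∃ c, b ≤ c ∧ Fin.cons c γ ∈ S ∧
        (Fin.cons c γ = α ∨ WinIn hn S α (Fin.cons c γ) m)) ∧
      ∀ c < b, Fin.cons c γ ∈ S → (Fin.cons c γ = α ∨ WinIn hn S α (Fin.cons c γ) m) := by
  constructor
  · intro h
    generalize hβ : (Fin.snoc γ b : Str (n + 1) k) = β at h
    cases h with
    | passWin _ _ c hc hcS heq hW =>
      subst hβ
      simp only [lastSym_snoc, shift_snoc] at *
      exact ⟨⟨c, hc, hcS, .inl heq⟩, fun c' hc' hS => or_iff_not_imp_left.2 (hW c' hc' hS)⟩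
    | passStep _ _ c hc hcS hwin hW =>
      subst hβ
      simp only [lastSym_snoc, shift_snoc] at *
      exact ⟨⟨c, hc, hcS, .inr hwin⟩, fun c' hc' hS => or_iff_not_imp_left.2 (hW c' hc' hS)⟩
  · rintro ⟨⟨c, hc, hcS, heq | hwin⟩, hW⟩
    · refine .passWin _ _ c ?_ ?_ ?_ fun c' => ?_ <;> simp only [lastSym_snoc, shift_snoc]
      exacts [hc, hcS, heq, fun hc' hS => or_iff_not_imp_left.1 (hW c' hc' hS)]
    · refine .passStep _ _ c ?_ ?_ ?_ fun c' => ?_ <;> simp only [lastSym_snoc, shift_snoc]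
      exacts [hc, hcS, hwin, fun hc' hS => or_iff_not_imp_left.1 (hW c' hc' hS)]

theorem WinIn.succ {n k : ℕ} {hn : 0 < n} {S : Set (Str n k)} {α β : Str n k} {m : ℕ}
    (h : WinIn hn S α β m) : WinIn hn S α β (m + 1) := by
  induction h with
  | passWin β m c hc hcS heq _ ih => exact .passWin β _ c hc hcS heq ih
  | passStep β m c hc hcS _ _ ihw ih => exact .passStep β _ c hc hcS ihw ih

theorem winIn_snoc_of_le {n k : ℕ} {hn : 0 < n + 1} {S : Set (Str (n + 1) k)}
    {α : Str (n + 1) k} {γ : Fin n → Fin k} {b b' : Fin k} {m : ℕ} (hb : b' ≤ b)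
    (h : WinIn hn S α (Fin.snoc γ b) m) : WinIn hn S α (Fin.snoc γ b') m := by
  cases m with
  | zero => exact absurd h not_winIn_zero
  | succ m =>
    obtain ⟨⟨c, hc, h⟩, hW⟩ := winIn_snoc_succ.1 h
    exact winIn_snoc_succ.2 ⟨⟨c, hb.trans hc, h⟩, fun c' hc' => hW c' (hc'.trans_le hb)⟩

/-- A finset `A` that is a lower set relative to an equinumerous finset `B` has the smaller
sum, and the two sums agree only if `A = B`. -/
theorem eq_or_sum_lt_of_lower {k : ℕ} {A B : Finset (Fin k)} (hcard : A.card = B.card)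
    (hlow : ∀ x ∈ A, ∀ y ∈ B, y ≤ x → y ∈ A) :
    A = B ∨ ∑ a ∈ A, a.val < ∑ b ∈ B, b.val := by
  have hcd := Finset.card_sdiff_comm hcard
  rcases (A \ B).eq_empty_or_nonempty with h | h
  · exact .inl (Finset.eq_of_subset_of_card_le (Finset.sdiff_eq_empty_iff_subset.1 h) hcard.ge)
  · right
    have hA := Finset.sum_inter_add_sum_sdiff A B (fun a : Fin k => a.val)
    have hB := Finset.sum_inter_add_sum_sdiff B A (fun a : Fin k => a.val)
    rw [Finset.inter_comm] at hB
    obtain ⟨hMA, hMB⟩ := Finset.mem_sdiff.1 ((A \ B).max'_mem h)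
    have h1 : ∑ a ∈ A \ B, a.val ≤ (A \ B).card • ((A \ B).max' h).val :=
      Finset.sum_le_card_nsmul _ _ _ fun x hx => (A \ B).le_max' x hx
    have h2 : (B \ A).card • (((A \ B).max' h).val + 1) ≤ ∑ b ∈ B \ A, b.val := by
      refine Finset.card_nsmul_le_sum _ _ _ fun y hy => ?_
      obtain ⟨hyB, hyA⟩ := Finset.mem_sdiff.1 hy
      exact not_le.1 fun hle => hyA (hlow _ hMA y hyB hle)
    have hpos := h.card_pos
    rw [← hcd, smul_eq_mul, mul_add, mul_one] at h2
    rw [smul_eq_mul] at h1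
    omega

open Classical in
theorem sum_filter_eq_sum_snoc {n k : ℕ} (P : Str (n + 1) k → Prop) (f : Str (n + 1) k → ℕ) :
    ∑ β with P β, f β =
      ∑ γ : Fin n → Fin k, ∑ b with P (Fin.snoc γ b), f (Fin.snoc γ b) := by
  simp only [Finset.sum_filter]
  rw [← (Fin.snocEquiv fun _ : Fin (n + 1) => Fin k).sum_comp, Fintype.sum_prod_type_right]
  rfl

open Classical in
theorem sum_filter_eq_sum_cons {n k : ℕ} (P : Str (n + 1) k → Prop) (f : Str (n + 1) k → ℕ) :
    ∑ β with P β, f β =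
      ∑ γ : Fin n → Fin k, ∑ c with P (Fin.cons c γ), f (Fin.cons c γ) := by
  simp only [Finset.sum_filter]
  rw [← (Fin.consEquiv fun _ : Fin (n + 1) => Fin k).sum_comp, Fintype.sum_prod_type_right]
  rfl

open Classical in
/-- A set of strings whose last-symbol fibres are lower sets relative to, and no larger than, its
first-symbol fibres is closed under rotation. -/
theorem snoc_iff_cons_of_card_le {n k : ℕ} (P : Str (n + 1) k → Prop)
    (hlow : ∀ (γ : Fin n → Fin k) (b c : Fin k),
      P (Fin.snoc γ b) → P (Fin.cons c γ) → c ≤ b → P (Fin.snoc γ c))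
    (hcard : ∀ γ : Fin n → Fin k, (Finset.univ.filter fun b => P (Fin.snoc γ b)).card ≤
      (Finset.univ.filter fun c => P (Fin.cons c γ)).card)
    (γ : Fin n → Fin k) (b : Fin k) : P (Fin.snoc γ b) ↔ P (Fin.cons b γ) := by
  set I : (Fin n → Fin k) → Finset (Fin k) :=
    fun γ => Finset.univ.filter fun b => P (Fin.snoc γ b) with hI
  set J : (Fin n → Fin k) → Finset (Fin k) :=
    fun γ => Finset.univ.filter fun c => P (Fin.cons c γ) with hJ
  have hsumcard : ∑ γ, (I γ).card = ∑ γ, (J γ).card := by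
    have h := (sum_filter_eq_sum_snoc P fun _ => 1).symm.trans (sum_filter_eq_sum_cons P fun _ => 1)
    simpa only [← Finset.card_eq_sum_ones] using h
  have hcardeq : ∀ γ, (I γ).card = (J γ).card := fun γ =>
    (Finset.sum_eq_sum_iff_of_le fun γ _ => hcard γ).1 hsumcard γ (Finset.mem_univ γ)
  have hsum : ∑ γ, ∑ b ∈ I γ, b.val = ∑ γ, ∑ c ∈ J γ, c.val := by
    have h := (sum_filter_eq_sum_snoc P fun β => ∑ i, (β i).val).symm.trans
      (sum_filter_eq_sum_cons P fun β => ∑ i, (β i).val)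
    simp only [Fin.sum_univ_castSucc (n := n) (fun i => ((Fin.snoc _ _ : Str (n + 1) k) i).val),
      Fin.sum_univ_succ (n := n) (fun i => ((Fin.cons _ _ : Str (n + 1) k) i).val),
      Fin.snoc_castSucc, Fin.snoc_last, Fin.cons_zero, Fin.cons_succ,
      Finset.sum_add_distrib, Finset.sum_const] at h
    change ∑ γ, (I γ).card • _ + _ = _ + ∑ γ, (J γ).card • _ at h
    simp only [hcardeq] at h
    rw [add_comm] at h
    exact Nat.add_right_cancel h
  have hdich : ∀ γ, I γ = J γ ∨ ∑ b ∈ I γ, b.val < ∑ c ∈ J γ, c.val := fun γ =>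
    eq_or_sum_lt_of_lower (hcardeq γ) fun x hx y hy hyx => by
      simp only [hI, hJ, Finset.mem_filter, Finset.mem_univ, true_and] at hx hy ⊢
      exact hlow γ x y hx hy hyx
  have hle : ∀ γ ∈ Finset.univ, ∑ b ∈ I γ, b.val ≤ ∑ c ∈ J γ, c.val := fun γ _ =>
    (hdich γ).elim (fun h => by rw [h]) le_of_lt
  have hIJ : I γ = J γ := (hdich γ).resolve_right
    ((Finset.sum_eq_sum_iff_of_le hle).1 hsum γ (Finset.mem_univ γ)).not_lt
  simpa [hI, hJ] using congrArg (b ∈ ·) hIJ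

open Classical in
theorem card_snoc_winIn_le {n k : ℕ} {hn : 0 < n + 1} {S : Set (Str (n + 1) k)}
    (hS : ClosedUnderRot S) {α : Str (n + 1) k} {m : ℕ} (hα : WinIn hn S α α m)
    (γ : Fin n → Fin k) :
    (Finset.univ.filter fun b => Fin.snoc γ b ∈ S ∧ WinIn hn S α (Fin.snoc γ b) m).card ≤
      (Finset.univ.filter fun c => Fin.cons c γ ∈ S ∧ WinIn hn S α (Fin.cons c γ) m).card := by
  cases m with
  | zero => exact absurd hα not_winIn_zero
  | succ m =>
    set I := Finset.univ.filter fun b => Fin.snoc γ b ∈ S ∧ WinIn hn S α (Fin.snoc γ b) (m + 1)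
      with hI
    set J := Finset.univ.filter fun c => Fin.cons c γ ∈ S ∧ WinIn hn S α (Fin.cons c γ) (m + 1)
      with hJ
    have hmem : ∀ c, Fin.cons c γ ∈ S →
        (Fin.cons c γ = α ∨ WinIn hn S α (Fin.cons c γ) m) → c ∈ J := by
      intro c hc h
      simp only [hJ, Finset.mem_filter, Finset.mem_univ, true_and]
      exact ⟨hc, h.elim (fun h => h ▸ hα) WinIn.succ⟩
    rcases I.eq_empty_or_nonempty with h | h
    · simp [h]
    have hM := I.max'_mem h
    obtain ⟨⟨c, hMc, hcS, hc⟩, hW⟩ := winIn_snoc_succ.1 (Finset.mem_filter.1 hM).2.2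
    have hsub : I.erase (I.max' h) ⊆ J.erase c := by
      intro b hb
      have hlt := I.lt_max'_of_mem_erase_max' h hb
      have hbI := Finset.mem_of_mem_erase hb
      simp only [hI, Finset.mem_filter, Finset.mem_univ, true_and] at hbI
      have hbS := hS.cons_mem hbI.1
      exact Finset.mem_erase.2 ⟨(hlt.trans_le hMc).ne, hmem b hbS (hW b hlt hbS)⟩
    have hle := Finset.card_le_card hsub
    have hcJ := hmem c hcS hc
    rw [Finset.card_erase_of_mem hM, Finset.card_erase_of_mem hcJ] at hle
    have := Finset.card_pos.2 ⟨c, hcJ⟩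
    omega

theorem winIn_snoc_iff_cons {n k : ℕ} {hn : 0 < n + 1} {S : Set (Str (n + 1) k)}
    (hS : ClosedUnderRot S) {α : Str (n + 1) k} {m : ℕ} (hα : WinIn hn S α α m)
    (γ : Fin n → Fin k) (b : Fin k) :
    (Fin.snoc γ b ∈ S ∧ WinIn hn S α (Fin.snoc γ b) m) ↔
      (Fin.cons b γ ∈ S ∧ WinIn hn S α (Fin.cons b γ) m) :=
  snoc_iff_cons_of_card_le (fun β => β ∈ S ∧ WinIn hn S α β m)
    (fun _ _ _ hb hc hle => ⟨hS.snoc_mem hc.1, winIn_snoc_of_le hle hb.2⟩)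
    (fun γ => by convert card_snoc_winIn_le hS hα γ) γ b

/-- Any bound on the length of the game started at the goal bounds every winnable game. -/
theorem WinIn.of_goal {n k : ℕ} {hn : 0 < n} {S : Set (Str n k)} (hS : ClosedUnderRot S)
    {α : Str n k} {m : ℕ} (hα : WinIn hn S α α m) {t : ℕ} :
    ∀ {β : Str n k}, β ∈ S → WinIn hn S α β t → WinIn hn S α β m := by
  obtain ⟨n, rfl⟩ : ∃ n', n = n' + 1 := ⟨n - 1, by omega⟩
  induction t with
  | zero => exact fun _ h => absurd h not_winIn_zero
  | succ t ih =>
    intro β hβ h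
    obtain ⟨γ, b, rfl⟩ : ∃ (γ : Fin n → Fin k) (b : Fin k), β = Fin.snoc γ b :=
      ⟨Fin.init β, β (Fin.last n), (Fin.snoc_init_self β).symm⟩
    obtain ⟨⟨c, hbc, hcS, hc⟩, -⟩ := winIn_snoc_succ.1 h
    have hcm : WinIn hn S α (Fin.cons c γ) m := hc.elim (fun h => h ▸ hα) (ih hcS)
    exact winIn_snoc_of_le hbc ((winIn_snoc_iff_cons hS hα γ c).2 ⟨hcS, hcm⟩).2

/-- treating the goal `α` also as a start position, no position of `S`
has finite remoteness exceeding `r(α)`. -/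
theorem goal_has_max_finite_remoteness {n k : ℕ} (hn : 0 < n) (S : Set (Str n k))
    (hS : ClosedUnderRot S) (α : Str n k) (hα : α ∈ S) :
    ∀ β ∈ S, remoteness hn S α β ≠ ⊤ →
      remoteness hn S α β ≤ remoteness hn S α α := by
  intro β hβ hfin
  obtain ⟨t, ht⟩ : ∃ t, WinIn hn S α β t := by
    by_contra! h
    exact hfin (by simp [remoteness, h])
  refine le_sInf ?_
  rintro _ ⟨m, rfl, hm⟩
  exact sInf_le ⟨m, rfl, WinIn.of_goal hS hm hβ ht⟩

end UCG
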